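/- Suppose k ≥ 2 and S is an optimal assignment map, and let j ∈ {1,…,ℓ}, s ∈ {1,…,k}. (i) If min_{i≠s} ‖y_j − x_i‖ < ρ_α(1, n_j)·‖y_j − x_s‖, then S(j) ≠ s. (ii) If ‖y_j − x_s‖ < ρ_α(1, n_j)·min_{i≠s} ‖y_j − x_i‖, then S(j) = s. -/

import Mathlib

open scoped BigOperators RealInnerProductSpace

noncomputable section

attribute [local instance] Classical.propDecidable

/-- Points of the ambient Euclidean space `ℝ^m`. -/
abbrev Pt (m : ℕ) := EuclideanSpace ℝ (Fin m)

/-- A weighted directed graph in `ℝ^m`: a finite vertex set, a finite set of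
directed edges (ordered pairs of points, viewed as directed line segments), and
a weight function. -/
structure WDG (m : ℕ) where
  V : Finset (Pt m)
  E : Finset (Pt m × Pt m)
  w : Pt m × Pt m → ℝ

namespace WDG

variable {m : ℕ}

/-- Edges join distinct vertices of the graph and carry positive weight. -/
def edgesOK (G : WDG m) : Prop :=
  ∀ e ∈ G.E, e.1 ∈ G.V ∧ e.2 ∈ G.V ∧ e.1 ≠ e.2 ∧ 0 < G.w e

/-- The underlying undirected (simple) graph. -/
def undirected (G : WDG m) : SimpleGraph (Pt m) :=
  SimpleGraph.fromRel (fun u v => (u, v) ∈ G.E)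

/-- The cost `M_α(G) = Σ_{e ∈ E(G)} w(e)^α · length(e)`. -/
def cost (α : ℝ) (G : WDG m) : ℝ :=
  ∑ e ∈ G.E, (G.w e) ^ α * dist e.1 e.2

/-- Total weight of edges starting at `v`. -/
def outflow (G : WDG m) (v : Pt m) : ℝ :=
  ∑ e ∈ G.E.filter (fun e => e.1 = v), G.w e

/-- Total weight of edges ending at `v`. -/
def inflow (G : WDG m) (v : Pt m) : ℝ :=
  ∑ e ∈ G.E.filter (fun e => e.2 = v), G.w e

end WDG

/-- Atomic measures are represented as finitely supported functions `ℝ^m →₀ ℝ`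
with nonnegative values; `AtomicOn X c` also requires the atoms to lie in `X`. -/
def AtomicOn {m : ℕ} (X : Set (Pt m)) (c : Pt m →₀ ℝ) : Prop :=
  (∀ z, 0 ≤ c z) ∧ ↑c.support ⊆ X

/-- The mass `m(c)` of an atomic measure. -/
def massOf {m : ℕ} (c : Pt m →₀ ℝ) : ℝ := c.sum fun _ t => t

/-- `G` is a transport path from `a` to `b` inside `X`: its vertices lie in `X`
and contain the atoms of `a` and `b`, its underlying undirected graph has no
cycles, and the balance equation holds at every vertex. -/
def IsTransportPath {m : ℕ} (X : Set (Pt m)) (G : WDG m) (a b : Pt m →₀ ℝ) : Prop :=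
  G.edgesOK ∧ ↑G.V ⊆ X ∧
  (∀ z ∈ a.support, z ∈ G.V) ∧ (∀ z ∈ b.support, z ∈ G.V) ∧
  G.undirected.IsAcyclic ∧
  ∀ v : Pt m, G.outflow v - G.inflow v = a v - b v

/-- `d_α(a,b)`: the minimal cost of a transport path from `a` to `b`. -/
def dCost {m : ℕ} (X : Set (Pt m)) (α : ℝ) (a b : Pt m →₀ ℝ) : ℝ :=
  sInf (WDG.cost α '' {G : WDG m | IsTransportPath X G a b})

/-- An optimal transport path from `a` to `b`. -/
def IsOptimalTP {m : ℕ} (X : Set (Pt m)) (α : ℝ) (G : WDG m) (a b : Pt m →₀ ℝ) : Prop :=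
  IsTransportPath X G a b ∧
    ∀ G' : WDG m, IsTransportPath X G' a b → WDG.cost α G ≤ WDG.cost α G'

/-- The atomic probability measure `b = Σ_j n_j δ_{y_j}` of households. -/
def bMeas {m ℓ : ℕ} (y : Fin ℓ → Pt m) (n : Fin ℓ → ℝ) : Pt m →₀ ℝ :=
  ∑ j, Finsupp.single (y j) (n j)

/-- An allocation path from the factory locations `x` to the households `(y,n)`:
a transport path to `b` from some atomic probability measure supported on the
factory locations. -/
def IsAllocPath {m k ℓ : ℕ} (X : Set (Pt m)) (x : Fin k → Pt m)
    (y : Fin ℓ → Pt m) (n : Fin ℓ → ℝ) (G : WDG m) : Prop :=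
  ∃ a : Pt m →₀ ℝ, (∀ z, 0 ≤ a z) ∧ ↑a.support ⊆ Set.range x ∧ massOf a = 1 ∧
    IsTransportPath X G a (bMeas y n)

/-- An optimal allocation path: it minimizes `M_α` over all allocation paths. -/
def IsOptimalAllocPath {m k ℓ : ℕ} (X : Set (Pt m)) (α : ℝ) (x : Fin k → Pt m)
    (y : Fin ℓ → Pt m) (n : Fin ℓ → ℝ) (G : WDG m) : Prop :=
  IsAllocPath X x y n G ∧
    ∀ G' : WDG m, IsAllocPath X x y n G' → WDG.cost α G ≤ WDG.cost α G'

/-- For an assignment map `S`, the part `b_i = Σ_{j : S(j) = i} n_j δ_{y_j}`. -/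
def bPart {m k ℓ : ℕ} (y : Fin ℓ → Pt m) (n : Fin ℓ → ℝ) (S : Fin ℓ → Fin k)
    (i : Fin k) : Pt m →₀ ℝ :=
  ∑ j ∈ Finset.univ.filter (fun j => S j = i), Finsupp.single (y j) (n j)

/-- The mass `m(b_i) = Σ_{j : S(j) = i} n_j`. -/
def mB {k ℓ : ℕ} (n : Fin ℓ → ℝ) (S : Fin ℓ → Fin k) (i : Fin k) : ℝ :=
  ∑ j ∈ Finset.univ.filter (fun j => S j = i), n j

/-- `E_α(S) = Σ_i d_α(m(b_i) δ_{x_i}, b_i)`. -/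
def Ealpha {m k ℓ : ℕ} (X : Set (Pt m)) (α : ℝ) (x : Fin k → Pt m)
    (y : Fin ℓ → Pt m) (n : Fin ℓ → ℝ) (S : Fin ℓ → Fin k) : ℝ :=
  ∑ i, dCost X α (Finsupp.single (x i) (mB n S i)) (bPart y n S i)

/-- An optimal assignment map minimizes `E_α` over all assignment maps. -/
def IsOptimalAssign {m k ℓ : ℕ} (X : Set (Pt m)) (α : ℝ) (x : Fin k → Pt m)
    (y : Fin ℓ → Pt m) (n : Fin ℓ → ℝ) (S : Fin ℓ → Fin k) : Prop :=
  ∀ S' : Fin ℓ → Fin k, Ealpha X α x y n S ≤ Ealpha X α x y n S'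

/-- `ρ_α(σ,ε)`: equals `(σ/ε)^α − (σ/ε − 1)^α` for `σ > ε` (and for `σ = ε` when
`α ∈ (0,1)`), and equals `1` when `σ = ε` (covering also the convention for `α = 0`). -/
def rho (α σ ε : ℝ) : ℝ :=
  if σ = ε then 1 else (σ / ε) ^ α - (σ / ε - 1) ^ α


/-- `G` is the disjoint union of the subgraphs `Gi`: the `Gi` have pairwise
disjoint vertex sets, each is a subgraph of `G` (with matching weights), and
the edges of `G` are exactly the (disjoint) union of their edges. -/
def IsDisjointUnion {m k : ℕ} (G : WDG m) (Gi : Fin k → WDG m) : Prop :=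
  (∀ i i' : Fin k, i ≠ i' → Disjoint (Gi i).V (Gi i').V) ∧
  (∀ i, (Gi i).V ⊆ G.V) ∧
  (∀ i, (Gi i).E ⊆ G.E) ∧
  (∀ i, ∀ e ∈ (Gi i).E, (Gi i).w e = G.w e) ∧
  G.E = Finset.univ.biUnion (fun i => (Gi i).E)

/-- The projection coordinate `π(z) = ⟨z − p, v⟩` along the line through `p`
in direction `v`. -/
def proj {m : ℕ} (p v z : Pt m) : ℝ := ⟪z - p, v⟫

/-- The constant `C = √(m−1)/(2^{1−(m−1)(1−α)} − 1) + 1`. -/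
def Cconst (m : ℕ) (α : ℝ) : ℝ :=
  Real.sqrt ((m : ℝ) - 1) / ((2 : ℝ) ^ (1 - ((m : ℝ) - 1) * (1 - α)) - 1) + 1


/-- The cost `t ^ α` per unit length of carrying the mass `t`, with the value `0` at `t = 0`. -/
def massCost (α t : ℝ) : ℝ := if t = 0 then 0 else t ^ α

lemma massCost_zero (α : ℝ) : massCost α 0 = 0 := if_pos rfl

lemma massCost_of_pos {α t : ℝ} (ht : 0 < t) : massCost α t = t ^ α := if_neg ht.ne'

lemma massCost_nonneg {α t : ℝ} (ht : 0 ≤ t) : 0 ≤ massCost α t := by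
  unfold massCost
  split_ifs
  exacts [le_rfl, Real.rpow_nonneg ht α]

lemma massCost_eq_rpow {α t : ℝ} (hα : 0 < α) : massCost α t = t ^ α := by
  unfold massCost
  split_ifs with h
  exacts [by rw [h, Real.zero_rpow hα.ne'], rfl]

lemma massCost_zero_left (t : ℝ) : massCost 0 t = if t = 0 then 0 else 1 := by
  simp [massCost]

lemma massCost_le_tangent {α : ℝ} (hα0 : 0 ≤ α) (hα1 : α ≤ 1) {r s : ℝ} (hr : 0 < r)
    (hs : 0 ≤ s) : massCost α s ≤ massCost α r + α * r ^ (α - 1) * (s - r) := by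
  have hpow : r ^ α = r ^ (α - 1) * r := by
    rw [← Real.rpow_add_one hr.ne', sub_add_cancel]
  have hpos : 0 < r ^ (α - 1) := Real.rpow_pos_of_pos hr _
  rw [massCost_of_pos hr]
  rcases hs.eq_or_lt with rfl | hs'
  · rw [massCost_zero, hpow]
    nlinarith [mul_pos hpos hr]
  · have hbern := rpow_one_add_le_one_add_mul_self (s := s / r - 1)
      (by linarith [div_nonneg hs hr.le]) hα0 hα1
    rw [massCost_of_pos hs']
    rw [add_sub_cancel, Real.div_rpow hs hr.le, div_le_iff₀ (Real.rpow_pos_of_pos hr α)] at hbern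
    refine hbern.trans_eq ?_
    rw [hpow]
    field_simp

lemma massCost_add_le {α : ℝ} (hα0 : 0 ≤ α) (hα1 : α ≤ 1) {s t : ℝ} (hs : 0 ≤ s)
    (ht : 0 ≤ t) : massCost α (s + t) ≤ massCost α s + massCost α t := by
  rcases hα0.eq_or_lt with rfl | hα
  · simp only [massCost_zero_left]
    grind
  · simp only [massCost_eq_rpow hα]
    exact Real.rpow_add_le_add_rpow hs ht hα0 hα1

lemma massCost_mono {α : ℝ} (hα0 : 0 ≤ α) {s t : ℝ} (hs : 0 ≤ s) (hst : s ≤ t) :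
    massCost α s ≤ massCost α t := by
  rcases hs.eq_or_lt with rfl | hs'
  · rw [massCost_zero]
    exact massCost_nonneg hst
  · rw [massCost_of_pos hs', massCost_of_pos (hs'.trans_le hst)]
    exact Real.rpow_le_rpow hs hst hα0

lemma massCost_sub_antitone {α : ℝ} (hα0 : 0 ≤ α) (hα1 : α ≤ 1) {ε w σ : ℝ} (hε : 0 < ε)
    (hεw : ε ≤ w) (hwσ : w ≤ σ) :
    massCost α σ - massCost α (σ - ε) ≤ massCost α w - massCost α (w - ε) := by
  rcases hα0.eq_or_lt with rfl | hα
  · simp only [massCost_zero_left]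
    grind
  · simp only [massCost_eq_rpow hα]
    have hc := Real.concaveOn_rpow hα0 hα1
    have hden : 0 < σ - w + ε := by linarith
    have h0 : w - ε ∈ Set.Ici (0 : ℝ) := by simpa using hεw
    have h1 : σ ∈ Set.Ici (0 : ℝ) := by simp; linarith
    have ha : 0 ≤ ε / (σ - w + ε) := by positivity
    have hb : 0 ≤ (σ - w) / (σ - w + ε) := div_nonneg (by linarith) hden.le
    have hab : ε / (σ - w + ε) + (σ - w) / (σ - w + ε) = 1 := by field_simp; ring
    have e1 := hc.2 h0 h1 ha hb hab
    have e2 := hc.2 h0 h1 hb ha (by linarith)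
    simp only [smul_eq_mul] at e1 e2
    have p1 : ε / (σ - w + ε) * (w - ε) + (σ - w) / (σ - w + ε) * σ = σ - ε := by
      field_simp; ring
    have p2 : (σ - w) / (σ - w + ε) * (w - ε) + ε / (σ - w + ε) * σ = w := by
      field_simp; ring
    rw [p1] at e1
    rw [p2] at e2
    have hb' : (σ - w) / (σ - w + ε) = 1 - ε / (σ - w + ε) := by linarith
    rw [hb'] at e1 e2
    linarith

lemma massCost_one_sub {α ε : ℝ} (hε : 0 < ε) (hε1 : ε ≤ 1) :
    massCost α 1 - massCost α (1 - ε) = ε ^ α * rho α 1 ε := by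
  have hε0 : ε ^ α ≠ 0 := (Real.rpow_pos_of_pos hε α).ne'
  unfold rho
  split_ifs with h
  · subst h; simp [massCost]
  · have hlt : ε < 1 := lt_of_le_of_ne hε1 (Ne.symm h)
    rw [massCost_of_pos one_pos, massCost_of_pos (by linarith),
      show 1 / ε - 1 = (1 - ε) / ε by field_simp, Real.div_rpow zero_le_one hε.le,
      Real.div_rpow (by linarith) hε.le]
    field_simp

section Flow

variable {P : Type*}

/-- The net outflow at every point of a flow, given by the mass carried by each directed edge. -/
def netOutflow (P : Type*) : (P × P →₀ ℝ) →ₗ[ℝ] (P →₀ ℝ) :=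
  Finsupp.linearCombination ℝ fun e => Finsupp.single e.1 1 - Finsupp.single e.2 1

lemma netOutflow_single (u v : P) (t : ℝ) :
    netOutflow P (Finsupp.single (u, v) t) = Finsupp.single u t - Finsupp.single v t := by
  simp [netOutflow, smul_sub]

/-- A flow is reduced if its support carries no nonzero circulation. -/
def IsReducedFlow (f : P × P →₀ ℝ) : Prop :=
  ∀ g : P × P →₀ ℝ, g.support ⊆ f.support → netOutflow P g = 0 → g = 0

lemma exists_netOutflow_of_reflTransGen {r : P → P → Prop} (C : AddSubmonoid (P × P →₀ ℝ))
    (hC : ∀ u v, r u v → ∃ h ∈ C, netOutflow P h = Finsupp.single u 1 - Finsupp.single v 1)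
    {u v : P} (huv : Relation.ReflTransGen r u v) :
    ∃ h ∈ C, netOutflow P h = Finsupp.single u 1 - Finsupp.single v 1 := by
  induction huv with
  | refl => exact ⟨0, C.zero_mem, by simp⟩
  | tail _ hr ih =>
    obtain ⟨h, hh, e⟩ := ih
    obtain ⟨h', hh', e'⟩ := hC _ _ hr
    exact ⟨h + h', C.add_mem hh hh', by rw [map_add, e, e']; abel⟩

lemma IsReducedFlow.netOutflow_injOn {f g h : P × P →₀ ℝ} (hf : IsReducedFlow f)
    (hg : g.support ⊆ f.support) (hh : h.support ⊆ f.support)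
    (he : netOutflow P g = netOutflow P h) : g = h :=
  sub_eq_zero.1 <| hf _ (Finsupp.support_sub.trans (Finset.union_subset hg hh))
    (by rw [map_sub, he, sub_self])

lemma IsReducedFlow.fst_ne_snd {f : P × P →₀ ℝ} (hf : IsReducedFlow f) {e : P × P}
    (he : e ∈ f.support) : e.1 ≠ e.2 := by
  intro h
  obtain ⟨u, v⟩ := e
  obtain rfl : u = v := h
  simpa using hf (Finsupp.single (u, u) 1)
    (Finsupp.support_single_subset.trans (by simpa using he)) (by simp [netOutflow_single])

/-- The support of a reduced flow has no directed closed walk. -/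
lemma IsReducedFlow.not_reflTransGen {f : P × P →₀ ℝ} (hf : IsReducedFlow f) {u v : P}
    (huv : (u, v) ∈ f.support)
    (hvu : Relation.ReflTransGen (fun a b => (a, b) ∈ f.support) v u) : False := by
  let C : AddSubmonoid (P × P →₀ ℝ) :=
    { carrier := {h | h.support ⊆ f.support ∧ ∀ e, 0 ≤ h e}
      zero_mem' := by simp
      add_mem' := fun ha hb => ⟨Finsupp.support_add.trans (Finset.union_subset ha.1 hb.1),
        fun e => add_nonneg (ha.2 e) (hb.2 e)⟩ }
  obtain ⟨h, ⟨hs, h0⟩, e⟩ := exists_netOutflow_of_reflTransGen C (fun a b hab =>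
    ⟨Finsupp.single (a, b) 1, ⟨Finsupp.support_single_subset.trans (by simpa using hab),
      fun e => by rw [Finsupp.single_apply]; split_ifs <;> norm_num⟩, netOutflow_single a b 1⟩) hvu
  have hz := hf (h + Finsupp.single (u, v) 1)
    (Finsupp.support_add.trans (Finset.union_subset hs
      (Finsupp.support_single_subset.trans (by simpa using huv))))
    (by rw [map_add, e, netOutflow_single]; abel)
  have := DFunLike.congr_fun hz (u, v)
  simp at this
  linarith [h0 (u, v)]

/-- The undirected graph underlying the support of a reduced flow has no cycles. -/
lemma IsReducedFlow.isAcyclic {f : P × P →₀ ℝ} (hf : IsReducedFlow f) :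
    (SimpleGraph.fromRel fun u v => (u, v) ∈ f.support).IsAcyclic := by
  rw [SimpleGraph.isAcyclic_iff_forall_adj_isBridge]
  have key : ∀ v w, (v, w) ∈ f.support →
      (SimpleGraph.fromRel fun u v => (u, v) ∈ f.support).IsBridge s(v, w) := by
    intro v w hvw
    rw [SimpleGraph.isBridge_iff, SimpleGraph.reachable_iff_reflTransGen]
    intro hr
    let C : AddSubmonoid (P × P →₀ ℝ) :=
      { carrier := {h | h.support ⊆ f.support ∧ h (v, w) = 0}
        zero_mem' := by simp
        add_mem' := fun ha hb => ⟨Finsupp.support_add.trans (Finset.union_subset ha.1 hb.1),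
          by simp [ha.2, hb.2]⟩ }
    obtain ⟨h, ⟨hs, h0⟩, e⟩ := exists_netOutflow_of_reflTransGen C (fun a b hab => by
      rw [SimpleGraph.deleteEdges_adj, SimpleGraph.fromRel_adj] at hab
      obtain ⟨⟨-, hab | hab⟩, hne⟩ := hab
      · refine ⟨Finsupp.single (a, b) 1, ⟨Finsupp.support_single_subset.trans (by simpa using hab),
          ?_⟩, netOutflow_single a b 1⟩
        refine Finsupp.single_eq_of_ne ?_
        rintro ⟨⟩
        simp at hne
      · refine ⟨Finsupp.single (b, a) (-1),
          ⟨Finsupp.support_single_subset.trans (by simpa using hab), ?_⟩, ?_⟩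
        · refine Finsupp.single_eq_of_ne ?_
          rintro ⟨⟩
          simp at hne
        · rw [netOutflow_single, Finsupp.single_neg, Finsupp.single_neg]; abel) hr
    have hz := hf (h - Finsupp.single (v, w) 1)
      (Finsupp.support_sub.trans (Finset.union_subset hs
        (Finsupp.support_single_subset.trans (by simpa using hvw))))
      (by rw [map_sub, e, netOutflow_single]; abel)
    have := DFunLike.congr_fun hz (v, w)
    simp [h0] at this
  intro v w hvw
  rw [SimpleGraph.fromRel_adj] at hvw
  rcases hvw.2 with h | h
  · exact key v w h
  · rw [Sym2.eq_swap]
    exact key w v h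

/-- The flow carrying the mass `1` along each edge of a finite set. -/
def edgeFlow (Q : Finset (P × P)) : P × P →₀ ℝ := ∑ e ∈ Q, Finsupp.single e 1

lemma edgeFlow_apply (Q : Finset (P × P)) (e : P × P) :
    edgeFlow Q e = if e ∈ Q then 1 else 0 := by
  simp [edgeFlow, Finsupp.finsetSum_apply, Finsupp.single_apply]

lemma support_edgeFlow (Q : Finset (P × P)) : (edgeFlow Q).support = Q := by
  ext e
  simp [edgeFlow_apply]

/-- The net outflow of a flow from `x` delivering the mass `n j` to `y j` for each `j ∈ J`. -/
def sourceDemand {ι : Type*} (x : P) (y : ι → P) (n : ι → ℝ) (J : Finset ι) : P →₀ ℝ :=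
  ∑ j ∈ J, n j • (Finsupp.single x 1 - Finsupp.single (y j) 1)

lemma sourceDemand_eq {ι : Type*} (x : P) (y : ι → P) (n : ι → ℝ) (J : Finset ι) :
    sourceDemand x y n J =
      Finsupp.single x (∑ j ∈ J, n j) - ∑ j ∈ J, Finsupp.single (y j) (n j) := by
  simp [sourceDemand, smul_sub, Finset.sum_sub_distrib, Finsupp.single_finsetSum]

lemma reflTransGen_of_netOutflow {ι : Type*} {f : P × P →₀ ℝ} (hf0 : ∀ e, 0 ≤ f e) {x : P}
    {y : ι → P} {n : ι → ℝ} (hn : ∀ j, 0 < n j) {J : Finset ι}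
    (hdiv : netOutflow P f = sourceDemand x y n J) {j : ι} (hj : j ∈ J) :
    Relation.ReflTransGen (fun a b => (a, b) ∈ f.support) x (y j) := by
  by_contra hx
  let A : P → ℝ := fun v =>
    if Relation.ReflTransGen (fun a b => (a, b) ∈ f.support) v (y j) then 1 else 0
  have hA0 : ∀ v, 0 ≤ A v := fun v => by simp only [A]; split_ifs <;> norm_num
  have hA1 : ∀ v, Relation.ReflTransGen (fun a b => (a, b) ∈ f.support) v (y j) → A v = 1 :=
    fun v hv => if_pos hv
  have h1 : Finsupp.linearCombination ℝ A (netOutflow P f) =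
      f.sum fun e t => t * (A e.1 - A e.2) := by
    rw [netOutflow, Finsupp.linearCombination_apply ℝ f, map_finsuppSum]
    simp
  have h2 : Finsupp.linearCombination ℝ A (sourceDemand x y n J) =
      ∑ i ∈ J, n i * (A x - A (y i)) := by
    rw [sourceDemand, map_sum]
    simp
  have h3 : 0 ≤ f.sum fun e t => t * (A e.1 - A e.2) := by
    refine Finset.sum_nonneg fun e he => mul_nonneg (hf0 e) ?_
    by_cases h : Relation.ReflTransGen (fun a b => (a, b) ∈ f.support) e.2 (y j)
    · have : Relation.ReflTransGen (fun a b => (a, b) ∈ f.support) e.1 (y j) :=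
        Relation.ReflTransGen.head he h
      rw [hA1 _ h, hA1 _ this, sub_self]
    · have : A e.2 = 0 := if_neg h
      rw [this, sub_zero]
      exact hA0 e.1
  have hAx : A x = 0 := if_neg hx
  have hAy : A (y j) = 1 := hA1 _ .refl
  have h4 : ∑ i ∈ J, n i * (A x - A (y i)) < 0 := by
    refine Finset.sum_neg' (fun i _ => ?_) ⟨j, hj, ?_⟩
    · rw [hAx]; nlinarith [hn i, hA0 (y i)]
    · rw [hAx, hAy]; linarith [hn j]
  rw [hdiv, h2] at h1
  linarith

section Cost

variable [PseudoMetricSpace P]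

/-- The cost `∑ f(e) ^ α * length(e)` of a flow. -/
def flowCost (α : ℝ) (f : P × P →₀ ℝ) : ℝ := f.sum fun e t => massCost α t * dist e.1 e.2

lemma flowCost_eq_sum (α : ℝ) {f : P × P →₀ ℝ} {T : Finset (P × P)} (hT : f.support ⊆ T) :
    flowCost α f = ∑ e ∈ T, massCost α (f e) * dist e.1 e.2 :=
  Finsupp.sum_of_support_subset f hT _ fun e _ => by rw [massCost_zero, zero_mul]

lemma flowCost_add_single_le {α : ℝ} (hα0 : 0 ≤ α) (hα1 : α ≤ 1) {f : P × P →₀ ℝ}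
    (hf0 : ∀ e, 0 ≤ f e) (u v : P) {t : ℝ} (ht : 0 < t) :
    flowCost α (f + Finsupp.single (u, v) t) ≤ flowCost α f + t ^ α * dist u v := by
  have hT : (u, v) ∈ insert (u, v) f.support := Finset.mem_insert_self _ _
  rw [flowCost_eq_sum α (f := f) (Finset.subset_insert (u, v) f.support),
    flowCost_eq_sum α (T := insert (u, v) f.support)]
  · have h : t ^ α * dist u v = ∑ e ∈ insert (u, v) f.support,
        massCost α (Finsupp.single (u, v) t e) * dist e.1 e.2 := by
      rw [Finset.sum_eq_single_of_mem _ hT, Finsupp.single_eq_same, massCost_of_pos ht]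
      intro e _ he
      rw [Finsupp.single_eq_of_ne he, massCost_zero, zero_mul]
    rw [h, ← Finset.sum_add_distrib]
    refine Finset.sum_le_sum fun e _ => ?_
    rw [← add_mul, Finsupp.add_apply]
    refine mul_le_mul_of_nonneg_right (massCost_add_le hα0 hα1 (hf0 e) ?_) dist_nonneg
    rw [Finsupp.single_apply]
    split_ifs
    exacts [ht.le, le_rfl]
  · refine Finsupp.support_add.trans (Finset.union_subset (Finset.subset_insert _ _) ?_)
    exact Finsupp.support_single_subset.trans (by simp)

/-- Subtracting a circulation along which the cost does not increase to first order, until some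
edge becomes empty. -/
lemma exists_flow_support_ssubset_aux {α : ℝ} (hα0 : 0 ≤ α) (hα1 : α ≤ 1) {f g : P × P →₀ ℝ}
    (hf0 : ∀ e, 0 ≤ f e) (hgs : g.support ⊆ f.support) (hg : netOutflow P g = 0)
    (hpos : ∃ e, 0 < g e)
    (hslope : 0 ≤ ∑ e ∈ f.support, α * f e ^ (α - 1) * g e * dist e.1 e.2) :
    ∃ f' : P × P →₀ ℝ, (∀ e, 0 ≤ f' e) ∧ f'.support ⊂ f.support ∧
      netOutflow P f' = netOutflow P f ∧ flowCost α f' ≤ flowCost α f := by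
  have hfpos : ∀ e ∈ f.support, 0 < f e := fun e he =>
    (hf0 e).lt_of_ne' (Finsupp.mem_support_iff.1 he)
  obtain ⟨e₁, he₁⟩ := hpos
  obtain ⟨e₀, he₀, hmin⟩ := (g.support.filter fun e => 0 < g e).exists_min_image
    (fun e => f e / g e) ⟨e₁, by simp [he₁, he₁.ne']⟩
  simp only [Finset.mem_filter] at he₀ hmin
  set t := f e₀ / g e₀ with ht
  have ht0 : 0 ≤ t := div_nonneg (hf0 _) he₀.2.le
  have hsub : (f - t • g).support ⊆ f.support :=
    Finsupp.support_sub.trans (Finset.union_subset le_rfl (Finsupp.support_smul.trans hgs))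
  have hnn : ∀ e, 0 ≤ (f - t • g) e := by
    intro e
    simp only [Finsupp.sub_apply, Finsupp.smul_apply, smul_eq_mul, sub_nonneg]
    by_cases h : 0 < g e
    · exact (le_div_iff₀ h).1 (hmin e ⟨by simpa using h.ne', h⟩)
    · exact (mul_nonpos_of_nonneg_of_nonpos ht0 (not_lt.1 h)).trans (hf0 e)
  refine ⟨f - t • g, hnn, ?_, by rw [map_sub, map_smul, hg, smul_zero, sub_zero], ?_⟩
  · refine (Finset.ssubset_iff_of_subset hsub).2 ⟨e₀, hgs he₀.1, ?_⟩
    simp [ht, he₀.2.ne']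
  · rw [flowCost_eq_sum α hsub, flowCost_eq_sum α (Finset.Subset.refl f.support)]
    calc ∑ e ∈ f.support, massCost α ((f - t • g) e) * dist e.1 e.2
        ≤ ∑ e ∈ f.support, (massCost α (f e) * dist e.1 e.2 -
            t * (α * f e ^ (α - 1) * g e * dist e.1 e.2)) := by
          refine Finset.sum_le_sum fun e he => ?_
          have h := mul_le_mul_of_nonneg_right
            (massCost_le_tangent hα0 hα1 (hfpos e he) (hnn e)) (dist_nonneg (x := e.1) (y := e.2))
          refine h.trans_eq ?_
          simp only [Finsupp.sub_apply, Finsupp.smul_apply, smul_eq_mul]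
          ring
      _ ≤ _ := by
          rw [Finset.sum_sub_distrib, ← Finset.mul_sum]
          linarith [mul_nonneg ht0 hslope]

lemma exists_flow_support_ssubset {α : ℝ} (hα0 : 0 ≤ α) (hα1 : α ≤ 1) {f : P × P →₀ ℝ}
    (hf0 : ∀ e, 0 ≤ f e) (hf : ¬ IsReducedFlow f) :
    ∃ f' : P × P →₀ ℝ, (∀ e, 0 ≤ f' e) ∧ f'.support ⊂ f.support ∧
      netOutflow P f' = netOutflow P f ∧ flowCost α f' ≤ flowCost α f := by
  unfold IsReducedFlow at hf
  push Not at hf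
  obtain ⟨g, hgs, hg, hg0⟩ := hf
  have hneg : (-g).support ⊆ f.support := by rwa [Finsupp.support_neg]
  have hgn : netOutflow P (-g) = 0 := by rw [map_neg, hg, neg_zero]
  have hslope : ∑ e ∈ f.support, α * f e ^ (α - 1) * (-g) e * dist e.1 e.2 =
      -∑ e ∈ f.support, α * f e ^ (α - 1) * g e * dist e.1 e.2 := by
    rw [← Finset.sum_neg_distrib]
    exact Finset.sum_congr rfl fun e _ => by rw [Finsupp.neg_apply]; ring
  have hsign : ∀ h : P × P →₀ ℝ, (¬ ∃ e, 0 < h e) →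
      ∑ e ∈ f.support, α * f e ^ (α - 1) * h e * dist e.1 e.2 ≤ 0 := fun h hh => by
    push Not at hh
    exact Finset.sum_nonpos fun e _ => mul_nonpos_of_nonpos_of_nonneg
      (mul_nonpos_of_nonneg_of_nonpos (mul_nonneg hα0 (Real.rpow_nonneg (hf0 e) _)) (hh e))
      dist_nonneg
  obtain ⟨e, he⟩ := DFunLike.ne_iff.1 hg0
  have hex : (∃ e, 0 < g e) ∨ ∃ e, 0 < (-g) e := by
    rcases lt_or_gt_of_ne he with h | h
    · exact Or.inr ⟨e, by simpa using h⟩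
    · exact Or.inl ⟨e, h⟩
  by_cases h1 : 0 ≤ ∑ e ∈ f.support, α * f e ^ (α - 1) * g e * dist e.1 e.2
  · by_cases h2 : ∃ e, 0 < g e
    · exact exists_flow_support_ssubset_aux hα0 hα1 hf0 hgs hg h2 h1
    · exact exists_flow_support_ssubset_aux hα0 hα1 hf0 hneg hgn (hex.resolve_left h2)
        (by linarith [hsign g h2])
  · by_cases h2 : ∃ e, 0 < (-g) e
    · exact exists_flow_support_ssubset_aux hα0 hα1 hf0 hneg hgn h2 (by linarith)
    · linarith [hsign (-g) h2]

/-- Every flow can be replaced by a reduced one on fewer edges, without increasing the cost. -/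
lemma exists_isReducedFlow {α : ℝ} (hα0 : 0 ≤ α) (hα1 : α ≤ 1) (f : P × P →₀ ℝ)
    (hf0 : ∀ e, 0 ≤ f e) :
    ∃ f' : P × P →₀ ℝ, IsReducedFlow f' ∧ (∀ e, 0 ≤ f' e) ∧ f'.support ⊆ f.support ∧
      netOutflow P f' = netOutflow P f ∧ flowCost α f' ≤ flowCost α f := by
  induction hN : f.support.card using Nat.strong_induction_on generalizing f with
  | _ N ih =>
    by_cases hf : IsReducedFlow f
    · exact ⟨f, hf, hf0, subset_rfl, rfl, le_rfl⟩
    · obtain ⟨f₁, h0, hs, hd, hc⟩ := exists_flow_support_ssubset hα0 hα1 hf0 hf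
      obtain ⟨f₂, hr, h0', hs', hd', hc'⟩ :=
        ih _ (hN ▸ Finset.card_lt_card hs) f₁ h0 rfl
      exact ⟨f₂, hr, h0', hs'.trans hs.1, hd'.trans hd, hc'.trans hc⟩

/-- A directed walk in the support of a reduced flow uses every edge at most once. -/
lemma IsReducedFlow.exists_path {f : P × P →₀ ℝ} (hf : IsReducedFlow f) {x z : P}
    (hxz : Relation.ReflTransGen (fun a b => (a, b) ∈ f.support) x z) :
    ∃ Q ⊆ f.support, netOutflow P (edgeFlow Q) = Finsupp.single x 1 - Finsupp.single z 1 ∧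
      dist x z ≤ ∑ e ∈ Q, dist e.1 e.2 := by
  suffices h : ∃ Q ⊆ f.support,
      netOutflow P (edgeFlow Q) = Finsupp.single x 1 - Finsupp.single z 1 ∧
      dist x z ≤ ∑ e ∈ Q, dist e.1 e.2 ∧
      ∀ e ∈ Q, Relation.ReflTransGen (fun a b => (a, b) ∈ f.support) e.2 z by
    obtain ⟨Q, h1, h2, h3, -⟩ := h
    exact ⟨Q, h1, h2, h3⟩
  induction hxz with
  | refl => exact ⟨∅, by simp, by simp [edgeFlow], by simp, by simp⟩
  | @tail c d _ hcd ih =>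
    obtain ⟨Q, hQ, hdiv, hdist, hreach⟩ := ih
    have hnot : (c, d) ∉ Q := fun h => hf.not_reflTransGen hcd (hreach _ h)
    refine ⟨insert (c, d) Q, Finset.insert_subset hcd hQ, ?_, ?_, ?_⟩
    · have : edgeFlow (insert (c, d) Q) = Finsupp.single (c, d) 1 + edgeFlow Q :=
        Finset.sum_insert hnot
      rw [this, map_add, netOutflow_single, hdiv]
      abel
    · rw [Finset.sum_insert hnot]
      linarith [dist_triangle x c d]
    · intro e he
      rcases Finset.mem_insert.1 he with rfl | he
      exacts [.refl, (hreach e he).tail hcd]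

/-- Stopping the delivery to `y j` in a reduced single-source flow of total mass at most `σ`. -/
lemma IsReducedFlow.exists_erase {α : ℝ} (hα0 : 0 ≤ α) (hα1 : α ≤ 1) {ι : Type*} [DecidableEq ι]
    {f : P × P →₀ ℝ} (hf : IsReducedFlow f) (hf0 : ∀ e, 0 ≤ f e) {x : P}
    {y : ι → P} {n : ι → ℝ} (hn : ∀ j, 0 < n j) {J : Finset ι}
    (hdiv : netOutflow P f = sourceDemand x y n J) {σ : ℝ} (hσ : ∑ i ∈ J, n i ≤ σ)
    {j : ι} (hj : j ∈ J) :
    ∃ f' : P × P →₀ ℝ, (∀ e, 0 ≤ f' e) ∧ f'.support ⊆ f.support ∧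
      netOutflow P f' = sourceDemand x y n (J.erase j) ∧
      flowCost α f' ≤
        flowCost α f - (massCost α σ - massCost α (σ - n j)) * dist x (y j) := by
  choose! Q hQs hQdiv hQdist using fun i (hi : i ∈ J) =>
    hf.exists_path (reflTransGen_of_netOutflow hf0 hn hdiv hi)
  have hsupp : ∀ K ⊆ J, (∑ i ∈ K, n i • edgeFlow (Q i)).support ⊆ f.support := by
    intro K hK
    refine Finsupp.support_finsetSum.trans (Finset.biUnion_subset.2 fun i hi => ?_)
    exact Finsupp.support_smul.trans ((support_edgeFlow _).trans_subset (hQs i (hK hi)))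
  have hnet : ∀ K ⊆ J, netOutflow P (∑ i ∈ K, n i • edgeFlow (Q i)) = sourceDemand x y n K := by
    intro K hK
    rw [map_sum]
    exact Finset.sum_congr rfl fun i hi => by rw [map_smul, hQdiv i (hK hi)]
  have hfeq : f = ∑ i ∈ J, n i • edgeFlow (Q i) :=
    hf.netOutflow_injOn subset_rfl (hsupp J subset_rfl) (hdiv.trans (hnet J subset_rfl).symm)
  have hval : ∀ K : Finset ι, ∀ e, (∑ i ∈ K, n i • edgeFlow (Q i)) e =
      ∑ i ∈ K, if e ∈ Q i then n i else 0 := by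
    intro K e
    simp [Finsupp.finsetSum_apply, edgeFlow_apply]
  have hK := Finset.erase_subset j J
  set f' := ∑ i ∈ J.erase j, n i • edgeFlow (Q i) with hf'
  have hf'0 : ∀ e, 0 ≤ f' e := fun e => by
    rw [hval]
    exact Finset.sum_nonneg fun i _ => by split_ifs; exacts [(hn i).le, le_rfl]
  have hsplit : ∀ e, f e = f' e + if e ∈ Q j then n j else 0 := fun e => by
    conv_lhs => rw [hfeq]
    rw [hval, hval, Finset.sum_erase_add J _ hj]
  have hfσ : ∀ e, f e ≤ σ := fun e => by
    rw [hfeq, hval]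
    exact (Finset.sum_le_sum fun i _ => by split_ifs; exacts [le_rfl, (hn i).le]).trans hσ
  have hnσ : n j ≤ σ := (Finset.single_le_sum (fun i _ => (hn i).le) hj).trans hσ
  refine ⟨f', hf'0, hsupp _ hK, hnet _ hK, ?_⟩
  set B := massCost α σ - massCost α (σ - n j) with hB
  have hB0 : 0 ≤ B := sub_nonneg.2 (massCost_mono hα0 (sub_nonneg.2 hnσ) (by linarith [hn j]))
  rw [flowCost_eq_sum α (hsupp _ hK), flowCost_eq_sum α (Finset.Subset.refl f.support)]
  have hle : ∑ e ∈ f.support, massCost α (f' e) * dist e.1 e.2 ≤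
      ∑ e ∈ f.support, (massCost α (f e) * dist e.1 e.2 -
        if e ∈ Q j then B * dist e.1 e.2 else 0) := by
    refine Finset.sum_le_sum fun e _ => ?_
    by_cases he : e ∈ Q j
    · have h1 : f e = f' e + n j := by rw [hsplit e, if_pos he]
      have h2 := massCost_sub_antitone hα0 hα1 (hn j) (by linarith [hf'0 e]) (hfσ e)
      rw [show f e - n j = f' e by linarith] at h2
      rw [if_pos he, ← sub_mul]
      exact mul_le_mul_of_nonneg_right (by linarith) dist_nonneg
    · rw [hsplit e, if_neg he, if_neg he, add_zero, sub_zero]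
  refine hle.trans ?_
  rw [Finset.sum_sub_distrib, ← Finset.sum_filter, Finset.filter_mem_eq_inter,
    Finset.inter_eq_right.2 (hQs j hj), ← Finset.mul_sum]
  linarith [mul_le_mul_of_nonneg_left (hQdist j hj) hB0]

end Cost

end Flow

lemma netOutflow_apply {P : Type*} {f : P × P →₀ ℝ} {T : Finset (P × P)} (hT : f.support ⊆ T)
    (v : P) : netOutflow P f v =
      ∑ e ∈ T.filter (fun e => e.1 = v), f e - ∑ e ∈ T.filter (fun e => e.2 = v), f e := by
  rw [netOutflow, Finsupp.linearCombination_apply, Finsupp.sum_of_support_subset f hT _ (by simp),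
    Finsupp.finsetSum_apply, Finset.sum_filter, Finset.sum_filter, ← Finset.sum_sub_distrib]
  refine Finset.sum_congr rfl fun e _ => ?_
  simp only [Finsupp.smul_apply, Finsupp.sub_apply, Finsupp.single_apply, smul_eq_mul]
  split_ifs <;> ring

section TransportPath

variable {m : ℕ} {X : Set (Pt m)} {a b : Pt m →₀ ℝ}

lemma WDG.cost_nonneg {G : WDG m} (hG : G.edgesOK) (α : ℝ) : 0 ≤ G.cost α :=
  Finset.sum_nonneg fun e he =>
    mul_nonneg (Real.rpow_nonneg (hG e he).2.2.2.le _) dist_nonneg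

lemma IsTransportPath.exists_flow {G : WDG m} (hG : IsTransportPath X G a b) (α : ℝ) :
    ∃ f : Pt m × Pt m →₀ ℝ, (∀ e, 0 ≤ f e) ∧ (∀ e ∈ f.support, e.1 ∈ X ∧ e.2 ∈ X) ∧
      netOutflow (Pt m) f = a - b ∧ flowCost α f = G.cost α := by
  obtain ⟨hE, hVX, -, -, -, hbal⟩ := hG
  let f : Pt m × Pt m →₀ ℝ := Finsupp.indicator G.E fun e _ => G.w e
  have hf : ∀ e ∈ G.E, f e = G.w e := fun e he => Finsupp.indicator_of_mem he _
  have hsupp : f.support ⊆ G.E := Finsupp.support_indicator_subset _ _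
  refine ⟨f, fun e => ?_, fun e he => ?_, ?_, ?_⟩
  · by_cases he : e ∈ G.E
    · exact (hf e he).symm ▸ (hE e he).2.2.2.le
    · exact (Finsupp.indicator_of_notMem he _).ge
  · obtain ⟨h1, h2, -⟩ := hE e (hsupp he)
    exact ⟨hVX h1, hVX h2⟩
  · ext v
    rw [netOutflow_apply hsupp, Finsupp.sub_apply, ← hbal v]
    unfold WDG.outflow WDG.inflow
    congr 1
    all_goals
      refine Finset.sum_congr (by congr) fun e he => hf e (Finset.mem_filter.1 he).1
  · rw [flowCost_eq_sum α hsupp]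
    refine Finset.sum_congr rfl fun e he => ?_
    rw [hf e he, massCost_of_pos (hE e he).2.2.2]

lemma IsReducedFlow.exists_isTransportPath {f : Pt m × Pt m →₀ ℝ} (hf : IsReducedFlow f)
    (hf0 : ∀ e, 0 ≤ f e) (hfX : ∀ e ∈ f.support, e.1 ∈ X ∧ e.2 ∈ X) (ha : ↑a.support ⊆ X)
    (hb : ↑b.support ⊆ X) (hdiv : netOutflow (Pt m) f = a - b) (α : ℝ) :
    ∃ G : WDG m, IsTransportPath X G a b ∧ G.cost α = flowCost α f := by
  have hpos : ∀ e ∈ f.support, 0 < f e := fun e he =>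
    (hf0 e).lt_of_ne' (Finsupp.mem_support_iff.1 he)
  refine ⟨⟨f.support.image Prod.fst ∪ f.support.image Prod.snd ∪ (a.support ∪ b.support),
    f.support, f⟩, ⟨fun e he => ⟨?_, ?_, hf.fst_ne_snd he, hpos e he⟩, ?_, ?_, ?_,
      hf.isAcyclic, fun v => ?_⟩, ?_⟩
  · exact Finset.mem_union_left _ (Finset.mem_union_left _ (Finset.mem_image_of_mem _ he))
  · exact Finset.mem_union_left _ (Finset.mem_union_right _ (Finset.mem_image_of_mem _ he))
  · intro v hv
    simp only [Finset.coe_union, Finset.coe_image, Set.mem_union, Set.mem_image] at hv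
    rcases hv with (⟨e, he, rfl⟩ | ⟨e, he, rfl⟩) | hv | hv
    exacts [(hfX e he).1, (hfX e he).2, ha hv, hb hv]
  · exact fun z hz => Finset.mem_union_right _ (Finset.mem_union_left _ hz)
  · exact fun z hz => Finset.mem_union_right _ (Finset.mem_union_right _ hz)
  · rw [← Finsupp.sub_apply, ← hdiv, netOutflow_apply subset_rfl]
    unfold WDG.outflow WDG.inflow
    congr!
  · rw [flowCost_eq_sum α (Finset.Subset.refl _)]
    exact Finset.sum_congr rfl fun e he => by rw [massCost_of_pos (hpos e he)]

variable {α : ℝ}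

lemma exists_isTransportPath_le (hα0 : 0 ≤ α) (hα1 : α ≤ 1) {f : Pt m × Pt m →₀ ℝ}
    (hf0 : ∀ e, 0 ≤ f e) (hfX : ∀ e ∈ f.support, e.1 ∈ X ∧ e.2 ∈ X) (ha : ↑a.support ⊆ X)
    (hb : ↑b.support ⊆ X) (hdiv : netOutflow (Pt m) f = a - b) :
    ∃ G : WDG m, IsTransportPath X G a b ∧ G.cost α ≤ flowCost α f := by
  obtain ⟨f', hr, h0, hs, hd, hc⟩ := exists_isReducedFlow hα0 hα1 f hf0
  obtain ⟨G, hG, hGc⟩ := hr.exists_isTransportPath h0 (fun e he => hfX e (hs he)) ha hb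
    (hd.trans hdiv) α
  exact ⟨G, hG, hGc.trans_le hc⟩

lemma dCost_le_flowCost (hα0 : 0 ≤ α) (hα1 : α ≤ 1) {f : Pt m × Pt m →₀ ℝ}
    (hf0 : ∀ e, 0 ≤ f e) (hfX : ∀ e ∈ f.support, e.1 ∈ X ∧ e.2 ∈ X) (ha : ↑a.support ⊆ X)
    (hb : ↑b.support ⊆ X) (hdiv : netOutflow (Pt m) f = a - b) :
    dCost X α a b ≤ flowCost α f := by
  obtain ⟨G, hG, hGc⟩ := exists_isTransportPath_le hα0 hα1 hf0 hfX ha hb hdiv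
  have hbdd : BddBelow (WDG.cost α '' {G : WDG m | IsTransportPath X G a b}) := by
    refine ⟨0, ?_⟩
    rintro _ ⟨G', hG', rfl⟩
    exact WDG.cost_nonneg hG'.1 α
  exact (csInf_le hbdd ⟨G, hG, rfl⟩).trans hGc

lemma exists_isReducedFlow_lt (hα0 : 0 ≤ α) (hα1 : α ≤ 1)
    (hne : ∃ G : WDG m, IsTransportPath X G a b) {c : ℝ} (hc : dCost X α a b < c) :
    ∃ f : Pt m × Pt m →₀ ℝ, IsReducedFlow f ∧ (∀ e, 0 ≤ f e) ∧
      (∀ e ∈ f.support, e.1 ∈ X ∧ e.2 ∈ X) ∧ netOutflow (Pt m) f = a - b ∧ flowCost α f < c := by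
  obtain ⟨_, ⟨G, hG, rfl⟩, hGc⟩ := exists_lt_of_csInf_lt (Set.Nonempty.image _ hne) hc
  obtain ⟨f, h0, hX, hd, hfc⟩ := IsTransportPath.exists_flow hG α
  obtain ⟨f', hr, h0', hs, hd', hc'⟩ := exists_isReducedFlow hα0 hα1 f h0
  exact ⟨f', hr, h0', fun e he => hX e (hs he), hd'.trans hd, hc'.trans_lt (hfc.trans_lt hGc)⟩

end TransportPath

section SingleSource

variable {m : ℕ} {X : Set (Pt m)} {α : ℝ} {ι : Type*}

/-- The minimal cost of supplying the households in `J` from the single factory `z`. -/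
def sourceCost (X : Set (Pt m)) (α : ℝ) (z : Pt m) (y : ι → Pt m) (n : ι → ℝ) (J : Finset ι) :
    ℝ :=
  dCost X α (Finsupp.single z (∑ j ∈ J, n j)) (∑ j ∈ J, Finsupp.single (y j) (n j))

variable {z : Pt m} {y : ι → Pt m} {n : ι → ℝ}

lemma support_single_subset_of_mem (hz : z ∈ X) (t : ℝ) : ↑(Finsupp.single z t).support ⊆ X := by
  refine (Finset.coe_subset.2 Finsupp.support_single_subset).trans ?_
  simpa using hz

lemma support_sum_single_subset (hy : ∀ j, y j ∈ X) (J : Finset ι) :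
    ↑(∑ j ∈ J, Finsupp.single (y j) (n j)).support ⊆ X := by
  intro v hv
  obtain ⟨j, -, hj⟩ := Finset.mem_biUnion.1 (Finsupp.support_finsetSum hv)
  exact support_single_subset_of_mem (hy j) _ hj

lemma exists_isTransportPath_source (hα0 : 0 ≤ α) (hα1 : α ≤ 1) (hz : z ∈ X)
    (hy : ∀ j, y j ∈ X) (hn : ∀ j, 0 < n j) (J : Finset ι) :
    ∃ G : WDG m, IsTransportPath X G (Finsupp.single z (∑ j ∈ J, n j))
      (∑ j ∈ J, Finsupp.single (y j) (n j)) := by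
  have hf0 : ∀ e, 0 ≤ (∑ j ∈ J, Finsupp.single (z, y j) (n j)) e := fun e => by
    rw [Finsupp.finsetSum_apply]
    refine Finset.sum_nonneg fun j _ => ?_
    rw [Finsupp.single_apply]
    split_ifs
    exacts [(hn j).le, le_rfl]
  have hfX : ∀ e ∈ (∑ j ∈ J, Finsupp.single (z, y j) (n j)).support, e.1 ∈ X ∧ e.2 ∈ X := by
    intro e he
    obtain ⟨j, -, hj⟩ := Finset.mem_biUnion.1 (Finsupp.support_finsetSum he)
    obtain rfl := Finset.mem_singleton.1 (Finsupp.support_single_subset hj)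
    exact ⟨hz, hy j⟩
  have hdiv : netOutflow (Pt m) (∑ j ∈ J, Finsupp.single (z, y j) (n j)) =
      sourceDemand z y n J := by
    rw [map_sum]
    exact Finset.sum_congr rfl fun j _ => by simp [netOutflow_single, smul_sub]
  obtain ⟨G, hG, -⟩ := exists_isTransportPath_le hα0 hα1 hf0 hfX
    (support_single_subset_of_mem hz _) (support_sum_single_subset hy J)
    (hdiv.trans (sourceDemand_eq z y n J))
  exact ⟨G, hG⟩

lemma sourceCost_insert_le (hα0 : 0 ≤ α) (hα1 : α ≤ 1) (hz : z ∈ X) (hy : ∀ j, y j ∈ X)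
    (hn : ∀ j, 0 < n j) [DecidableEq ι] {J : Finset ι} {j : ι} (hj : j ∉ J) :
    sourceCost X α z y n (insert j J) ≤ sourceCost X α z y n J + n j ^ α * dist z (y j) := by
  refine le_of_forall_pos_lt_add fun ε hε => ?_
  obtain ⟨f, -, h0, hX, hd, hc⟩ := exists_isReducedFlow_lt hα0 hα1
    (exists_isTransportPath_source hα0 hα1 hz hy hn J)
    (show sourceCost X α z y n J < sourceCost X α z y n J + ε by linarith)
  have hle := dCost_le_flowCost hα0 hα1 (X := X) (f := f + Finsupp.single (z, y j) (n j))
    (fun e => ?_) (fun e he => ?_) (support_single_subset_of_mem hz _)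
    (support_sum_single_subset hy (insert j J))
    ((?_ : _ = sourceDemand z y n (insert j J)).trans (sourceDemand_eq z y n _))
  · have := flowCost_add_single_le hα0 hα1 h0 z (y j) (hn j)
    unfold sourceCost at *
    linarith
  · refine add_nonneg (h0 e) ?_
    rw [Finsupp.single_apply]
    split_ifs
    exacts [(hn j).le, le_rfl]
  · rcases Finset.mem_union.1 (Finsupp.support_add he) with he | he
    · exact hX e he
    · obtain rfl := Finset.mem_singleton.1 (Finsupp.support_single_subset he)
      exact ⟨hz, hy j⟩
  · rw [map_add, hd, ← sourceDemand_eq, netOutflow_single, sourceDemand, sourceDemand,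
      Finset.sum_insert hj, add_comm]
    simp [smul_sub]

lemma sourceCost_erase_le (hα0 : 0 ≤ α) (hα1 : α ≤ 1) (hz : z ∈ X) (hy : ∀ j, y j ∈ X)
    (hn : ∀ j, 0 < n j) [DecidableEq ι] {J : Finset ι} (hJ : ∑ i ∈ J, n i ≤ 1) {j : ι} (hj : j ∈ J) :
    sourceCost X α z y n (J.erase j) ≤
      sourceCost X α z y n J - n j ^ α * rho α 1 (n j) * dist z (y j) := by
  refine le_of_forall_pos_lt_add fun ε hε => ?_
  obtain ⟨f, hr, h0, hX, hd, hc⟩ := exists_isReducedFlow_lt hα0 hα1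
    (exists_isTransportPath_source hα0 hα1 hz hy hn J)
    (show sourceCost X α z y n J < sourceCost X α z y n J + ε by linarith)
  obtain ⟨f', h0', hs', hd', hc'⟩ :=
    hr.exists_erase hα0 hα1 h0 hn (hd.trans (sourceDemand_eq z y n J).symm) hJ hj
  rw [massCost_one_sub (hn j) ((Finset.single_le_sum (fun i _ => (hn i).le) hj).trans hJ)] at hc'
  have hle := dCost_le_flowCost hα0 hα1 h0' (fun e he => hX e (hs' he))
    (support_single_subset_of_mem hz _) (support_sum_single_subset hy (J.erase j))
    (hd'.trans (sourceDemand_eq z y n _))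
  unfold sourceCost at *
  linarith

end SingleSource

lemma IsOptimalAssign.le_of_ne {m k ℓ : ℕ} {X : Set (Pt m)} {α : ℝ} (hα0 : 0 ≤ α) (hα1 : α ≤ 1)
    {x : Fin k → Pt m} (hxX : ∀ i, x i ∈ X) {y : Fin ℓ → Pt m} (hyX : ∀ j, y j ∈ X)
    {n : Fin ℓ → ℝ} (hn : ∀ j, 0 < n j) (hnsum : ∑ j, n j = 1) {S : Fin ℓ → Fin k}
    (hS : IsOptimalAssign X α x y n S) (j : Fin ℓ) {i : Fin k} (hi : i ≠ S j) :
    rho α 1 (n j) * ‖y j - x (S j)‖ ≤ ‖y j - x i‖ := by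
  set S' : Fin ℓ → Fin k := Function.update S j i with hS'
  have hE : ∀ T : Fin ℓ → Fin k, Ealpha X α x y n T =
      ∑ i, sourceCost X α (x i) y n (Finset.univ.filter fun j => T j = i) := fun _ => rfl
  have hopt := hS S'
  rw [hE, hE] at hopt
  have hins : (Finset.univ.filter fun j' => S' j' = i) =
      insert j (Finset.univ.filter fun j' => S j' = i) := by
    ext j'
    by_cases h : j' = j <;> simp [hS', h]
  have hers : (Finset.univ.filter fun j' => S' j' = S j) =
      (Finset.univ.filter fun j' => S j' = S j).erase j := by
    ext j'
    by_cases h : j' = j <;> simp [hS', h, hi]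
  have hrest : ∀ i', i' ≠ i → i' ≠ S j → (Finset.univ.filter fun j' => S' j' = i') =
      Finset.univ.filter fun j' => S j' = i' := by
    intro i' h1 h2
    ext j'
    by_cases h : j' = j <;> simp [hS', h, h1.symm, h2.symm]
  have hadd := sourceCost_insert_le hα0 hα1 (hxX i) hyX hn
    (J := Finset.univ.filter fun j' => S j' = i) (j := j) (by simpa using hi.symm)
  have hrem := sourceCost_erase_le hα0 hα1 (hxX (S j)) hyX hn
    (J := Finset.univ.filter fun j' => S j' = S j) (j := j)
    ((Finset.sum_le_sum_of_subset_of_nonneg (Finset.subset_univ _)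
      fun j' _ _ => (hn j').le).trans hnsum.le) (by simp)
  rw [← hins] at hadd
  rw [← hers] at hrem
  have hpair : ∀ F : Fin k → ℝ, ∑ i', F i' =
      F i + F (S j) + ∑ i' ∈ (Finset.univ.erase i).erase (S j), F i' := by
    intro F
    rw [← Finset.add_sum_erase _ F (Finset.mem_univ i),
      ← Finset.add_sum_erase _ F (Finset.mem_erase.2 ⟨hi.symm, Finset.mem_univ _⟩), add_assoc]
  rw [hpair, hpair, Finset.sum_congr rfl fun i' h => by
    rw [← hrest i' (Finset.ne_of_mem_erase (Finset.mem_of_mem_erase h))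
      (Finset.ne_of_mem_erase h)]] at hopt
  have hpos : 0 < n j ^ α := Real.rpow_pos_of_pos (hn j) α
  rw [← dist_eq_norm, ← dist_eq_norm, dist_comm, dist_comm (y j)]
  refine le_of_mul_le_mul_left ?_ hpos
  linarith

/-- (i) If `min_(i≠s) ‖y_j − x_i‖ < ρ_α(1, n_j) ‖y_j − x_s‖`
then `S(j) ≠ s`; (ii) if `‖y_j − x_s‖ < ρ_α(1, n_j) min_(i≠s) ‖y_j − x_i‖` then
`S(j) = s`, for any optimal assignment map `S`. -/
theorem stmt_11 {m k ℓ : ℕ} (X : Set (Pt m)) (hXc : IsCompact X) (hXconv : Convex ℝ X)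
    (α : ℝ) (hα0 : 0 ≤ α) (hα1 : α < 1)
    (x : Fin k → Pt m) (hxinj : Function.Injective x) (hxX : ∀ i, x i ∈ X)
    (y : Fin ℓ → Pt m) (hyinj : Function.Injective y) (hyX : ∀ j, y j ∈ X)
    (n : Fin ℓ → ℝ) (hn : ∀ j, 0 < n j) (hnsum : ∑ j, n j = 1)
    (hk : 2 ≤ k) (S : Fin ℓ → Fin k) (hS : IsOptimalAssign X α x y n S)
    (j : Fin ℓ) (s : Fin k) :
    ((∃ i : Fin k, i ≠ s ∧ ‖y j - x i‖ < rho α 1 (n j) * ‖y j - x s‖) → S j ≠ s) ∧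
    ((∀ i : Fin k, i ≠ s → ‖y j - x s‖ < rho α 1 (n j) * ‖y j - x i‖) → S j = s) := by
  have key : ∀ i, i ≠ S j → rho α 1 (n j) * ‖y j - x (S j)‖ ≤ ‖y j - x i‖ := fun i hi =>
    hS.le_of_ne hα0 hα1.le hxX hyX hn hnsum j hi
  constructor
  · rintro ⟨i, his, hlt⟩ rfl
    exact (key i his).not_gt hlt
  · intro h
    by_contra hne
    exact (key s (Ne.symm hne)).not_gt (h (S j) hne)

end
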